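/- arXiv:1212.3534 — 6 statements merged into one kernel-verified Lean document; each statement's English description precedes it below -/
import Mathlib

section
/- Fix m ≥ 1, a type T of tile types, compatibility relations Hc, Vc ⊆ T × T, and prescribed tiles t_0, ..., t_{m-1} ∈ T. Suppose there exists a function h : (Fin (2m) → Bool) → T such that: (i) for every k < m and all u, v : Fin (2m) → Bool, if u ℓ ≠ v ℓ for all ℓ with k ≤ ℓ < m and u ℓ = v ℓ for all other ℓ < 2m, then (h u, h v) ∈ Hc; (ii) for every k < m and all u, v, if u ℓ ≠ v ℓ for all ℓ with m + k ≤ ℓ < 2m and u ℓ = v ℓ for all other ℓ < 2m, then (h u, h v) ∈ Vc; (iii) for every k < m, h(w_k) = t_k, where w_k : Fin (2m) → Bool is the bit-vector whose first m bits are the big-endian binary encoding of k and whose last m bits are all false. Then there exists a valid tiling of the 2^m × 2^m grid with prescribed prefix, namely a function τ : ℕ × ℕ → T such that (τ(x,y), τ(x+1,y)) ∈ Hc whenever x+1 < 2^m and y < 2^m, (τ(x,y), τ(x,y+1)) ∈ Vc whenever x < 2^m and y+1 < 2^m, and τ(k, 0) = t_k for every k < m. Indeed, τ(x,y) = h(the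 length-2m bit-vector whose first m bits are the big-endian encoding of x and whose last m bits are the big-endian encoding of y) is such a tiling. -/
/-- The length-`2*m` bit-vector whose first `m` bits are the big-endian binary
encoding of `x` and whose last `m` bits are the big-endian binary encoding
of `y`. -/
def pairEnc (m x y : ℕ) (ℓ : Fin (2 * m)) : Bool :=
  if (ℓ : ℕ) < m then Nat.testBit x (m - 1 - (ℓ : ℕ))
  else Nat.testBit y (m - 1 - ((ℓ : ℕ) - m))

/-- Incrementing flips exactly the bits `0, ..., j`, where `j` is the lowest zero bit. -/
theorem succ_bits (m : ℕ) : ∀ x : ℕ, x + 1 < 2 ^ m → ∃ j, j < m ∧ ∀ i,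
    (i ≤ j → Nat.testBit x i ≠ Nat.testBit (x + 1) i) ∧
    (j < i → Nat.testBit x i = Nat.testBit (x + 1) i) := by
  induction m with
  | zero => intro x hx; simp at hx
  | succ m ih =>
    intro x hx
    rcases Nat.mod_two_eq_zero_or_one x with h0 | h1
    · refine ⟨0, Nat.succ_pos m, fun i => ⟨fun hi => ?_, fun hi => ?_⟩⟩
      · obtain rfl : i = 0 := by omega
        have h2 : (x + 1) % 2 = 1 := by omega
        simp [Nat.testBit_zero, h0, h2]
      · obtain ⟨i, rfl⟩ : ∃ k, i = k + 1 := ⟨i - 1, by omega⟩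
        have h2 : (x + 1) / 2 = x / 2 := by omega
        rw [Nat.testBit_succ, Nat.testBit_succ, h2]
    · have h2 : (x + 1) / 2 = x / 2 + 1 := by omega
      have h3 : (x + 1) % 2 = 0 := by omega
      obtain ⟨j, hj, H⟩ := ih (x / 2) (by rw [pow_succ] at hx; omega)
      refine ⟨j + 1, by omega, fun i => ?_⟩
      cases i with
      | zero => simp [Nat.testBit_zero, h1, h3]
      | succ i =>
        rw [Nat.testBit_succ, Nat.testBit_succ, h2]
        exact ⟨fun hi => (H i).1 (by omega), fun hi => (H i).2 (by omega)⟩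

/-- If `h : (Fin (2m) → Bool) → T` sends every `H_k`-related pair of bit-vectors
(differing exactly on bits `k ≤ ℓ < m`) to a horizontally compatible pair, every
`V_k`-related pair (differing exactly on bits `m + k ≤ ℓ < 2m`) to a vertically
compatible pair, and the encoding of `(k, 0)` to the prescribed tile `t k`, then
`τ (x, y) = h (pairEnc m x y)` is a valid tiling of the `2^m × 2^m` grid with
prescribed prefix `t 0, ..., t (m-1)` on the first row. -/
theorem stmt_1 (m : ℕ) (hm : 1 ≤ m) (T : Type) (Hc Vc : Set (T × T))
    (t : Fin m → T) (h : (Fin (2 * m) → Bool) → T)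
    (hH : ∀ k : ℕ, k < m → ∀ u v : Fin (2 * m) → Bool,
      (∀ ℓ : Fin (2 * m),
        (k ≤ (ℓ : ℕ) ∧ (ℓ : ℕ) < m → u ℓ ≠ v ℓ) ∧
        (¬ (k ≤ (ℓ : ℕ) ∧ (ℓ : ℕ) < m) → u ℓ = v ℓ)) →
      (h u, h v) ∈ Hc)
    (hV : ∀ k : ℕ, k < m → ∀ u v : Fin (2 * m) → Bool,
      (∀ ℓ : Fin (2 * m),
        (m + k ≤ (ℓ : ℕ) ∧ (ℓ : ℕ) < 2 * m → u ℓ ≠ v ℓ) ∧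
        (¬ (m + k ≤ (ℓ : ℕ) ∧ (ℓ : ℕ) < 2 * m) → u ℓ = v ℓ)) →
      (h u, h v) ∈ Vc)
    (hP : ∀ k : Fin m, h (pairEnc m k 0) = t k) :
    ∃ τ : ℕ × ℕ → T,
      (∀ x y : ℕ, x + 1 < 2 ^ m → y < 2 ^ m → (τ (x, y), τ (x + 1, y)) ∈ Hc) ∧
      (∀ x y : ℕ, x < 2 ^ m → y + 1 < 2 ^ m → (τ (x, y), τ (x, y + 1)) ∈ Vc) ∧
      (∀ k : Fin m, τ ((k : ℕ), 0) = t k) ∧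
      τ = fun xy => h (pairEnc m xy.1 xy.2) := by
  refine ⟨fun xy => h (pairEnc m xy.1 xy.2), ?_, ?_, hP, rfl⟩
  · intro x y hx _
    obtain ⟨j, hj, H⟩ := succ_bits m x hx
    refine hH (m - 1 - j) (by omega) _ _ fun l => ⟨fun hl => ?_, fun hl => ?_⟩
    · simp only [pairEnc, if_pos hl.2]
      exact (H _).1 (by omega)
    · by_cases hlm : (l : ℕ) < m
      · simp only [pairEnc, if_pos hlm]
        exact (H _).2 (by omega)
      · simp only [pairEnc, if_neg hlm]
  · intro x y _ hy
    obtain ⟨j, hj, H⟩ := succ_bits m y hy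
    refine hV (m - 1 - j) (by omega) _ _ fun l => ⟨fun hl => ?_, fun hl => ?_⟩
    · have hlm : ¬ (l : ℕ) < m := by omega
      simp only [pairEnc, if_neg hlm]
      exact (H _).1 (by omega)
    · by_cases hlm : (l : ℕ) < m
      · simp only [pairEnc, if_pos hlm]
      · have hl2 := l.isLt
        simp only [pairEnc, if_neg hlm]
        exact (H _).2 (by omega)
end

section
/- Assume n ≥ 1 and fix arities r_1, ..., r_k ≥ 1. Let A_1, ..., A_n and B be structures each carrying relations R_j ⊆ (Fin r_j → ·) for j = 1, ..., k, and let h : (Π i, A_i) → B be a homomorphism from the direct product of A_1, ..., A_n to B (i.e., h preserves every relation R_j, computed relation-wise in the product). Define h' : (Π i, Option A_i) → Option B by h'(v) = some (h (fun i => a_i)) if every component v i is of the form some a_i, and h'(v) = none otherwise. Then h' is a homomorphism from the direct product of A_1*, ..., A_n* to B*, i.e., h' preserves both the unary relation P and the r-ary relation R of the star construction. -/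
/-- Sum of the arities of the relations preceding the `j`-th one. -/
def blockOffset {k : ℕ} (r : Fin k → ℕ) (j : Fin k) : ℕ :=
  ∑ j' ∈ Finset.Iio j, r j'

lemma blockOffset_add_le {k : ℕ} (r : Fin k → ℕ) (j : Fin k) :
    blockOffset r j + r j ≤ ∑ j', r j' := by
  have : blockOffset r j + r j = ∑ j' ∈ insert j (Finset.Iio j), r j' := by
    rw [Finset.sum_insert (by simp), blockOffset]; omega
  rw [this]
  exact Finset.sum_le_sum_of_subset (Finset.subset_univ _)

/-- The padded tuple of arity `∑ j', r j'` whose entries on the `j`-th block of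
positions are `some (t ·)` and whose entries elsewhere are `none`. -/
def padded {k : ℕ} (r : Fin k → ℕ) {A : Type} (j : Fin k) (t : Fin (r j) → A)
    (p : Fin (∑ j', r j')) : Option A :=
  if hp : blockOffset r j ≤ (p : ℕ) ∧ (p : ℕ) < blockOffset r j + r j
  then some (t ⟨(p : ℕ) - blockOffset r j, by omega⟩)
  else none

/-- The single relation of arity `∑ j', r j'` of the structure `A*`: the constant
`none` tuple together with all padded tuples of tuples of the relations of `A`. -/
def starRel {k : ℕ} (r : Fin k → ℕ) {A : Type} (R : ∀ j, Set (Fin (r j) → A)) :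
    Set (Fin (∑ j', r j') → Option A) :=
  {v | (v = fun _ => none) ∨ ∃ j, ∃ t ∈ R j, v = padded r j t}

/-- The map `h'` induced on `Option`-domains by `h`: it sends `v` to
`some (h (fun i => a i))` if every component `v i` is of the form `some (a i)`,
and to `none` otherwise. -/
def starMap {n : ℕ} {A : Fin n → Type} {B : Type} (h : (∀ i, A i) → B)
    (v : ∀ i, Option (A i)) : Option B :=
  if hv : ∀ i, (v i).isSome then some (h fun i => (v i).get (hv i)) else none

lemma blockOffset_lt {k : ℕ} (r : Fin k → ℕ) {j j' : Fin k} (hj : j < j') :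
    blockOffset r j + r j ≤ blockOffset r j' := by
  have : blockOffset r j + r j = ∑ x ∈ insert j (Finset.Iio j), r x := by
    rw [Finset.sum_insert (by simp), blockOffset]; omega
  rw [this]
  refine Finset.sum_le_sum_of_subset ?_
  intro x hx
  simp only [Finset.mem_insert, Finset.mem_Iio] at hx ⊢
  rcases hx with rfl | hx
  · exact hj
  · exact hx.trans hj

lemma block_unique {k : ℕ} (r : Fin k → ℕ) {j j' : Fin k} {p : ℕ}
    (h1 : blockOffset r j ≤ p ∧ p < blockOffset r j + r j)
    (h2 : blockOffset r j' ≤ p ∧ p < blockOffset r j' + r j') : j = j' := by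
  rcases lt_trichotomy j j' with h | h | h
  · have := blockOffset_lt r h; omega
  · exact h
  · have := blockOffset_lt r h; omega

/-- If `h` is a homomorphism from the direct product of `A_1, ..., A_n` to `B`,
then `starMap h` is a homomorphism from the direct product of `A_1*, ..., A_n*`
to `B*`: it preserves the unary relation `P` and the `r`-ary relation `R` of the
star construction. -/
theorem stmt_2 (n : ℕ) (hn : 1 ≤ n) (k : ℕ) (r : Fin k → ℕ) (hr : ∀ j, 1 ≤ r j)
    (A : Fin n → Type) (B : Type)
    (RA : ∀ i, ∀ j, Set (Fin (r j) → A i)) (RB : ∀ j, Set (Fin (r j) → B))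
    (h : (∀ i, A i) → B)
    (hhom : ∀ (j : Fin k) (t : Fin (r j) → ∀ i, A i),
      (∀ i, (fun p => t p i) ∈ RA i j) → (fun p => h (t p)) ∈ RB j) :
    (∀ v : ∀ i, Option (A i),
        (∀ i, v i ∈ Set.range (some : A i → Option (A i))) →
        starMap h v ∈ Set.range (some : B → Option B)) ∧
    (∀ w : Fin (∑ j', r j') → ∀ i, Option (A i),
        (∀ i, (fun p => w p i) ∈ starRel r (RA i)) →
        (fun p => starMap h (w p)) ∈ starRel r RB) := by
  constructor
  · intro v hv
    have hv' : ∀ i, (v i).isSome := by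
      intro i
      obtain ⟨a, ha⟩ := hv i
      rw [← ha]; rfl
    exact ⟨h fun i => (v i).get (hv' i), by rw [starMap, dif_pos hv']⟩
  · intro w hw
    by_cases hp : ∃ p, ∀ i, (w p i).isSome
    · obtain ⟨p, hp⟩ := hp
      have key : ∀ i, ∃ j, (blockOffset r j ≤ (p : ℕ) ∧ (p : ℕ) < blockOffset r j + r j) ∧
          ∃ t ∈ RA i j, (fun p => w p i) = padded r j t := by
        intro i
        have hpi := hp i
        rcases hw i with h0 | ⟨j, t, ht, h0⟩
        · have : w p i = none := congrFun h0 p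
          simp [this] at hpi
        · refine ⟨j, ?_, t, ht, h0⟩
          by_contra hc
          have := congrFun h0 p
          simp only [padded, dif_neg hc] at this
          simp [this] at hpi
      obtain ⟨j, hj, -⟩ := key ⟨0, hn⟩
      have key2 : ∀ i, ∃ t ∈ RA i j, (fun p => w p i) = padded r j t := by
        intro i
        obtain ⟨j', hj', h2⟩ := key i
        obtain rfl := block_unique r hj hj'
        exact h2
      choose t ht hwt using key2
      refine Or.inr ⟨j, fun q => h fun i => t i q, hhom j (fun q i => t i q) ht, ?_⟩
      funext q
      have hq : w q = fun i => padded r j (t i) q := by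
        funext i
        exact congrFun (hwt i) q
      rw [hq]
      by_cases hb : blockOffset r j ≤ (q : ℕ) ∧ (q : ℕ) < blockOffset r j + r j
      · simp [starMap, padded, hb]
      · simp only [starMap, padded, dif_neg hb]
        rw [dif_neg]
        intro hc
        simpa using hc ⟨0, hn⟩
    · left
      funext p
      rw [starMap, dif_neg]
      exact fun hc => hp ⟨p, hc⟩
end

section
/- Let (B, S) be a structure of arity r ≥ 1 (S ⊆ (Fin r → B)) such that every element of B occurs as the first entry t(0) of some tuple t ∈ S. Then a vertex of the digraph G*(B, S) has an outgoing directed walk of length r if and only if it is (the copy of) an element of B. -/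
/-- There is an outgoing directed walk of length `ℓ` from `v` in the digraph
with edge relation `E`. -/
def hasWalk {V : Type} (E : V → V → Prop) (ℓ : ℕ) (v : V) : Prop :=
  ∃ w : Fin (ℓ + 1) → V, w 0 = v ∧ ∀ j : Fin ℓ, E (w j.castSucc) (w j.succ)

/-- The edge relation of the digraph `G(B, S)` associated with an `r`-ary
structure `(B, S)`: its vertices are the elements of `B` together with the
tuple-vertices `t^j` (for `t ∈ S`, `j < r`), with an edge from `t^j` to
`t^(j+1)` and an edge from the element `t j` to `t^j`. -/
def GEdge {r : ℕ} {B : Type} (S : Set (Fin r → B)) :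
    (B ⊕ (S × Fin r)) → (B ⊕ (S × Fin r)) → Prop
  | Sum.inr (t, j), Sum.inr (t', j') => t = t' ∧ (j' : ℕ) = (j : ℕ) + 1
  | Sum.inl b, Sum.inr (t, j) => (t : Fin r → B) j = b
  | _, _ => False

/-- The edge relation of the digraph `G*(B, S)`: `G(B, S)` extended with `r - 1`
sink vertices `s^1, ..., s^(r-1)`, with an edge from `s^j` to `s^(j+1)` and an
edge from every element of `B` to every sink vertex. -/
def GStarEdge {r : ℕ} {B : Type} (S : Set (Fin r → B)) :
    ((B ⊕ (S × Fin r)) ⊕ Fin (r - 1)) → ((B ⊕ (S × Fin r)) ⊕ Fin (r - 1)) → Prop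
  | Sum.inl u, Sum.inl v => GEdge S u v
  | Sum.inl (Sum.inl _), Sum.inr _ => True
  | Sum.inr j, Sum.inr j' => (j' : ℕ) = (j : ℕ) + 1
  | _, _ => False

/-- A height function that strictly increases along edges of `G*(B, S)`. -/
def starHeight {r : ℕ} {B : Type} (S : Set (Fin r → B)) :
    ((B ⊕ (S × Fin r)) ⊕ Fin (r - 1)) → ℕ
  | Sum.inl (Sum.inl _) => 0
  | Sum.inl (Sum.inr (_, j)) => (j : ℕ) + 1
  | Sum.inr j => (j : ℕ) + 1

theorem starHeight_le {r : ℕ} {B : Type} (S : Set (Fin r → B))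
    (v : (B ⊕ (S × Fin r)) ⊕ Fin (r - 1)) : starHeight S v ≤ r := by
  rcases v with (b | ⟨t, j⟩) | j <;> simp only [starHeight] <;> omega

theorem starHeight_lt {r : ℕ} {B : Type} (S : Set (Fin r → B))
    (u v : (B ⊕ (S × Fin r)) ⊕ Fin (r - 1)) (h : GStarEdge S u v) :
    starHeight S u < starHeight S v := by
  rcases u with (b | ⟨t, j⟩) | j <;> rcases v with (b' | ⟨t', j'⟩) | j' <;>
    simp only [GStarEdge, GEdge, starHeight] at h ⊢ <;> omega

/-- If every element of `B` occurs as the first entry of some tuple of `S`, then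
a vertex of `G*(B, S)` has an outgoing directed walk of length `r` iff it is
(the copy of) an element of `B`. -/
theorem stmt_6 (r : ℕ) (hr : 1 ≤ r) (B : Type) (S : Set (Fin r → B))
    (hS : ∀ b : B, ∃ t ∈ S, t ⟨0, hr⟩ = b) :
    ∀ v : (B ⊕ (S × Fin r)) ⊕ Fin (r - 1),
      hasWalk (GStarEdge S) r v ↔ ∃ b : B, v = Sum.inl (Sum.inl b) := by
  intro v
  constructor
  · rintro ⟨w, hw, hE⟩
    have key : ∀ i (hi : i < r + 1), starHeight S v + i ≤ starHeight S (w ⟨i, hi⟩) := by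
      intro i
      induction i with
      | zero => intro hi; rw [← hw]; exact le_refl _
      | succ k ih =>
        intro hi
        have h1 := ih (by omega)
        have h2 := starHeight_lt S _ _ (hE ⟨k, by omega⟩)
        simp only [Fin.castSucc_mk, Fin.succ_mk] at h2
        omega
    have h1 := key r (by omega)
    have h2 := starHeight_le S (w ⟨r, by omega⟩)
    have h0 : starHeight S v = 0 := by omega
    rcases v with (b | ⟨t, j⟩) | j
    · exact ⟨b, rfl⟩
    · simp [starHeight] at h0
    · simp [starHeight] at h0
  · rintro ⟨b, rfl⟩
    obtain ⟨t, ht, htb⟩ := hS b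
    refine ⟨Fin.cons (Sum.inl (Sum.inl b)) (fun j => Sum.inl (Sum.inr (⟨t, ht⟩, j))), rfl, ?_⟩
    rintro ⟨j, hj⟩
    rw [Fin.cons_succ]
    cases j with
    | zero => exact htb
    | succ k =>
      exact ⟨rfl, rfl⟩
end

section
/- Let (A_i, R_i), for i ∈ Fin n, and (B, S) be structures of arity r ≥ 1, and suppose that for every i, every element of A_i occurs as the first entry t(0) of some tuple t ∈ R_i. If h' is a digraph homomorphism from the direct product of the digraphs G(A_1, R_1), ..., G(A_n, R_n) to G*(B, S), then h' maps every vertex all of whose components are domain elements (i.e., an element of Π i, A_i) to (the copy of) an element of B, and the resulting restricted map is a homomorphism from the direct product of the structures (A_1, R_1), ..., (A_n, R_n) to (B, S). -/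
/-- Height function on `G*(B, S)`, strictly decreasing along edges. -/
def gsHeight {r : ℕ} {B : Type} (S : Set (Fin r → B)) :
    ((B ⊕ (S × Fin r)) ⊕ Fin (r - 1)) → ℕ
  | Sum.inl (Sum.inl _) => r
  | Sum.inl (Sum.inr (_, j)) => r - 1 - j
  | Sum.inr j => r - 2 - j

theorem gsHeight_edge {r : ℕ} {B : Type} (S : Set (Fin r → B))
    (u v : (B ⊕ (S × Fin r)) ⊕ Fin (r - 1)) (h : GStarEdge S u v) :
    gsHeight S v + 1 ≤ gsHeight S u := by
  rcases u with (b | ⟨t, j⟩) | j <;> rcases v with (b' | ⟨t', j'⟩) | j' <;>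
    simp only [GStarEdge, GEdge, gsHeight] at h ⊢
  · omega
  · omega
  · omega
  · omega

/-- Suppose that for every `i`, every element of `A i` occurs as the first entry
of some tuple of `R i`.  If `h'` is a digraph homomorphism from the direct
product of the digraphs `G(A_i, R_i)` to `G*(B, S)`, then `h'` maps every vertex
all of whose components are domain elements to (the copy of) an element of `B`,
and the resulting restricted map is a homomorphism from the direct product of
the structures `(A_i, R_i)` to `(B, S)`. -/
theorem stmt_9 (r : ℕ) (hr : 1 ≤ r) (n : ℕ)
    (A : Fin n → Type) (R : ∀ i, Set (Fin r → A i))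
    (B : Type) (S : Set (Fin r → B))
    (hR : ∀ i, ∀ a : A i, ∃ t ∈ R i, t ⟨0, hr⟩ = a)
    (h' : (∀ i, (A i) ⊕ ((R i) × Fin r)) → (B ⊕ (S × Fin r)) ⊕ Fin (r - 1))
    (hh' : ∀ u v, (∀ i, GEdge (R i) (u i) (v i)) → GStarEdge S (h' u) (h' v)) :
    ∃ h : (∀ i, A i) → B,
      (∀ a : ∀ i, A i, h' (fun i => Sum.inl (a i)) = Sum.inl (Sum.inl (h a))) ∧
      (∀ t : Fin r → ∀ i, A i,
        (∀ i, (fun x => t x i) ∈ R i) → (fun x => h (t x)) ∈ S) := by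
  have chain : ∀ T : ∀ i, R i, ∀ k (hk : k < r),
      gsHeight S (h' (fun i => Sum.inr (T i, ⟨k, hk⟩))) + k
        ≤ gsHeight S (h' (fun i => Sum.inr (T i, ⟨0, hr⟩))) := by
    intro T k
    induction k with
    | zero => intro hk; exact le_rfl
    | succ k ih =>
      intro hk
      have h1 := ih (by omega)
      have h2 := gsHeight_edge S _ _ (hh' (fun i => Sum.inr (T i, ⟨k, by omega⟩))
        (fun i => Sum.inr (T i, ⟨k + 1, hk⟩)) (fun i => ⟨rfl, rfl⟩))
      omega
  have h0 : ∀ T : ∀ i, R i,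
      r - 1 ≤ gsHeight S (h' (fun i => Sum.inr (T i, ⟨0, hr⟩))) := by
    intro T
    have := chain T (r - 1) (by omega)
    omega
  have hB : ∀ a : ∀ i, A i, ∃ b : B, h' (fun i => Sum.inl (a i)) = Sum.inl (Sum.inl b) := by
    intro a
    choose T hT hTa using fun i => hR i (a i)
    have h1 := h0 (fun i => ⟨T i, hT i⟩)
    have h2 := gsHeight_edge S _ _ (hh' (fun i => Sum.inl (a i))
      (fun i => Sum.inr (⟨T i, hT i⟩, ⟨0, hr⟩)) (fun i => hTa i))
    have h3 : r ≤ gsHeight S (h' (fun i => Sum.inl (a i))) := by omega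
    generalize h' (fun i => Sum.inl (a i)) = z at h3 ⊢
    rcases z with (b | ⟨t, j⟩) | j
    · exact ⟨b, rfl⟩
    · simp only [gsHeight] at h3; omega
    · simp only [gsHeight] at h3; omega
  choose h hh using hB
  refine ⟨h, hh, fun t ht => ?_⟩
  let T : ∀ i, R i := fun i => ⟨fun x => t x i, ht i⟩
  have hin : ∀ k : Fin r, GStarEdge S (Sum.inl (Sum.inl (h (t k))))
      (h' (fun i => Sum.inr (T i, k))) := by
    intro k
    rw [← hh]
    exact hh' _ _ (fun i => rfl)
  have hs : ∃ s : S, h' (fun i => Sum.inr (T i, ⟨0, hr⟩))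
      = Sum.inl (Sum.inr (s, ⟨0, hr⟩)) := by
    have h1 := h0 T
    have h2 := hin ⟨0, hr⟩
    generalize h' (fun i => Sum.inr (T i, ⟨0, hr⟩)) = z at h1 h2 ⊢
    rcases z with (b | ⟨s, j⟩) | j
    · exact h2.elim
    · simp only [gsHeight] at h1
      have : j = ⟨0, hr⟩ := Fin.ext (by simp only; omega)
      exact ⟨s, by rw [this]⟩
    · simp only [gsHeight] at h1; omega
  obtain ⟨s, hs⟩ := hs
  have hall : ∀ k (hk : k < r), h' (fun i => Sum.inr (T i, ⟨k, hk⟩))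
      = Sum.inl (Sum.inr (s, ⟨k, hk⟩)) := by
    intro k
    induction k with
    | zero => intro hk; exact hs
    | succ k ih =>
      intro hk
      have h2 := hh' (fun i => Sum.inr (T i, ⟨k, by omega⟩))
        (fun i => Sum.inr (T i, ⟨k + 1, hk⟩)) (fun i => ⟨rfl, rfl⟩)
      rw [ih (by omega)] at h2
      generalize h' (fun i => Sum.inr (T i, ⟨k + 1, hk⟩)) = z at h2 ⊢
      rcases z with (b | ⟨s', j⟩) | j
      · exact h2.elim
      · obtain ⟨e1, e2⟩ := h2
        have : j = ⟨k + 1, hk⟩ := Fin.ext e2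
        rw [this, e1]
      · exact h2.elim
  have : (fun x => h (t x)) = (s : Fin r → B) := by
    funext x
    have h1 := hin x
    rw [hall x.1 x.2] at h1
    exact h1.symm
  rw [this]
  exact s.2
end

section
/- Let (B, S) be a structure of arity r ≥ 1. Suppose b_0, ..., b_{r-1} are elements of B and y_0, ..., y_{r-1} are vertices of G*(B, S) such that, in G*(B, S), there is an edge from (the copy of) b_j to y_j for every j < r and an edge from y_j to y_{j+1} for every j < r−1. Then the tuple (b_0, ..., b_{r-1}) belongs to S. -/
/-- Any realization in `G*(B, S)` of the conjunctive-query pattern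
`q(x_0, ..., x_{r-1}) = ∃ y_0 ... y_{r-1} (⋀_j E(x_j, y_j) ∧ ⋀_j E(y_j, y_{j+1}))`
with all `x_j` instantiated by (copies of) elements `b j` of `B` forces
`(b 0, ..., b (r-1)) ∈ S`. -/
theorem stmt_10 (r : ℕ) (hr : 1 ≤ r) (B : Type) (S : Set (Fin r → B))
    (b : Fin r → B) (y : Fin r → (B ⊕ (S × Fin r)) ⊕ Fin (r - 1))
    (h1 : ∀ j : Fin r, GStarEdge S (Sum.inl (Sum.inl (b j))) (y j))
    (h2 : ∀ (j : ℕ) (hj : j + 1 < r),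
      GStarEdge S (y ⟨j, by omega⟩) (y ⟨j + 1, hj⟩)) :
    b ∈ S := by
  rcases h0 : y ⟨0, hr⟩ with (c | ⟨t, k⟩) | k
  · have h := h1 ⟨0, hr⟩
    rw [h0] at h
    exact h.elim
  · have key : ∀ (j : ℕ) (hj : j < r), ∃ k' : Fin r,
        y ⟨j, hj⟩ = Sum.inl (Sum.inr (t, k')) ∧ (k' : ℕ) = k + j := by
      intro j
      induction j with
      | zero => intro hj; exact ⟨k, h0, rfl⟩
      | succ j ih =>
        intro hj
        obtain ⟨k', e, hk⟩ := ih (by omega)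
        have h := h2 j hj
        rw [e] at h
        rcases h3 : y ⟨j + 1, hj⟩ with (c | ⟨t', k''⟩) | k''
        · rw [h3] at h; exact h.elim
        · rw [h3] at h
          obtain ⟨rfl, h⟩ := h
          exact ⟨k'', rfl, by omega⟩
        · rw [h3] at h; exact h.elim
    have hb : (t : Fin r → B) = b := by
      funext j
      obtain ⟨k1, -, hk1⟩ := key (r - 1) (by omega)
      obtain ⟨k', e, hk⟩ := key j j.2
      have hkj : k' = j := by
        apply Fin.ext
        have := k1.2
        omega
      subst hkj
      have h := h1 k'
      rw [show y k' = _ from e] at h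
      exact h
    exact hb ▸ t.2
  · exfalso
    have key : ∀ (j : ℕ) (hj : j < r), ∃ k' : Fin (r - 1),
        y ⟨j, hj⟩ = Sum.inr k' ∧ (k' : ℕ) = k + j := by
      intro j
      induction j with
      | zero => intro hj; exact ⟨k, h0, rfl⟩
      | succ j ih =>
        intro hj
        obtain ⟨k', e, hk⟩ := ih (by omega)
        have h := h2 j hj
        rw [e] at h
        rcases h3 : y ⟨j + 1, hj⟩ with c | k''
        · rw [h3] at h; exact h.elim
        · rw [h3] at h
          have h' : (k'' : ℕ) = (k' : ℕ) + 1 := h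
          exact ⟨k'', rfl, by omega⟩
    obtain ⟨k1, -, hk1⟩ := key (r - 1) (by omega)
    have := k1.2
    omega
end

section
/- Fix r ≥ 1. Let A_1, ..., A_n and B be digraphs such that none of A_1, ..., A_n, B contains a directed walk of length r+1, and such that the product digraph Π_i A_i contains a vertex with an outgoing directed walk of length r. Let C be the digraph on the disjoint union of A_1, ..., A_n, B together with n+1 fresh apex vertices a_1, ..., a_n, b, whose edges are all edges inside each copy, together with an edge from a_i to (the copy of) every vertex of A_i for each i, and an edge from b to (the copy of) every vertex of B. Then: (1) for every non-apex vertex x of C there is NO function f from the vertices of Π_i A_i to the vertices of C mapping every edge of Π_i A_i to an edge of C and such that there is an edge in C from x to f(t) for every vertex t of Π_i A_i; and (2) for each i ≤ n such a function with source a_i DOES exist, namely the i-th projection followed by the inclusion of A_i into C. -/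
/-- The edge relation of the digraph `C` on the disjoint union of the digraphs
`A_1, ..., A_n, B` together with `n + 1` fresh apex vertices `a_1, ..., a_n, b`:
all edges inside each copy, together with an edge from `a_i` to (the copy of)
every vertex of `A_i` for each `i`, and an edge from `b` to (the copy of) every
vertex of `B`. -/
def apexEdge2 {n : ℕ} {A : Fin n → Type} {B : Type}
    (EA : ∀ i, A i → A i → Prop) (EB : B → B → Prop) :
    (((Σ i, A i) ⊕ B) ⊕ (Fin n ⊕ Unit)) →
      (((Σ i, A i) ⊕ B) ⊕ (Fin n ⊕ Unit)) → Prop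
  | Sum.inl (Sum.inl x), Sum.inl (Sum.inl y) =>
      ∃ (i : Fin n) (u v : A i), EA i u v ∧ x = ⟨i, u⟩ ∧ y = ⟨i, v⟩
  | Sum.inl (Sum.inr x), Sum.inl (Sum.inr y) => EB x y
  | Sum.inr (Sum.inl i), Sum.inl (Sum.inl x) => x.1 = i
  | Sum.inr (Sum.inr _), Sum.inl (Sum.inr _) => True
  | _, _ => False

/-- Suppose none of `A_1, ..., A_n, B` contains a directed walk of length
`r + 1`, while the product digraph `Π_i A_i` contains a vertex with an outgoing
directed walk of length `r`.  Then (1) for every non-apex vertex `x` of the apex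
digraph `C` there is no edge-preserving function `f` from `Π_i A_i` to `C` with
an edge from `x` to `f t` for every `t`; and (2) for each `i` such a function
with source the apex `a_i` does exist, namely the `i`-th projection followed by
the inclusion of `A_i` into `C`. -/
theorem stmt_13 (r : ℕ) (hr : 1 ≤ r) (n : ℕ) (A : Fin n → Type) (B : Type)
    (EA : ∀ i, A i → A i → Prop) (EB : B → B → Prop)
    (hshortA : ∀ i, ¬ ∃ v, hasWalk (EA i) (r + 1) v)
    (hshortB : ¬ ∃ v, hasWalk EB (r + 1) v)
    (hlong : ∃ t : ∀ i, A i,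
      hasWalk (fun u v : ∀ i, A i => ∀ i, EA i (u i) (v i)) r t) :
    (∀ x : (Σ i, A i) ⊕ B,
        ¬ ∃ f : (∀ i, A i) → ((Σ i, A i) ⊕ B) ⊕ (Fin n ⊕ Unit),
          (∀ u v, (∀ i, EA i (u i) (v i)) → apexEdge2 EA EB (f u) (f v)) ∧
          (∀ t, apexEdge2 EA EB (Sum.inl x) (f t))) ∧
    (∀ i : Fin n,
        (∀ u v : ∀ i', A i', (∀ i', EA i' (u i') (v i')) →
          apexEdge2 EA EB (Sum.inl (Sum.inl ⟨i, u i⟩))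
            (Sum.inl (Sum.inl ⟨i, v i⟩))) ∧
        (∀ t : ∀ i', A i',
          apexEdge2 EA EB (Sum.inr (Sum.inl i)) (Sum.inl (Sum.inl ⟨i, t i⟩)))) := by
  obtain ⟨t0, w, hw0, hw⟩ := hlong
  refine ⟨?_, fun i => ⟨fun u v h => ⟨i, u i, v i, h i, rfl, rfl⟩, fun t => rfl⟩⟩
  rintro (⟨i, a⟩ | b) ⟨f, hf, hx⟩
  · have key : ∀ t, ∃ c : A i, EA i a c ∧ f t = Sum.inl (Sum.inl ⟨i, c⟩) := by
      intro t
      have h := hx t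
      rcases hft : f t with (y | y) | (y | y) <;> rw [hft] at h
      · obtain ⟨k, u, v, huv, h1, h2⟩ := h
        cases h1
        exact ⟨v, huv, by rw [h2]⟩
      all_goals exact h.elim
    choose g hg1 hg2 using key
    refine hshortA i ⟨a, Fin.cons a (fun j => g (w j)), rfl, ?_⟩
    intro j
    refine Fin.cases ?_ (fun j => ?_) j
    · exact hg1 _
    · have h := hf _ _ (hw j)
      rw [hg2, hg2] at h
      obtain ⟨k, u, v, huv, h1, h2⟩ := h
      cases h1
      cases h2
      exact huv
  · have key : ∀ t, ∃ c : B, EB b c ∧ f t = Sum.inl (Sum.inr c) := by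
      intro t
      have h := hx t
      rcases hft : f t with (y | y) | (y | y) <;> rw [hft] at h
      · exact h.elim
      · exact ⟨y, h, rfl⟩
      all_goals exact h.elim
    choose g hg1 hg2 using key
    refine hshortB ⟨b, Fin.cons b (fun j => g (w j)), rfl, ?_⟩
    intro j
    refine Fin.cases ?_ (fun j => ?_) j
    · exact hg1 _
    · have h := hf _ _ (hw j)
      rw [hg2, hg2] at h
      exact h
end
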